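/- arXiv:2007.08562 — 2 statements merged into one kernel-verified Lean document; each statement's English description precedes it below -/
import Mathlib

section
/- Let R → S̃ → S be surjective homomorphisms of commutative noetherian local rings such that R → S̃ is complete intersection (kernel generated by a regular sequence), and suppose S has finite projective dimension over S̃. If R → S (the composite) is such that the induced map Ker(R→S̃)/m·Ker(R→S̃) → Ker(R→S)/m·Ker(R→S) is injective, and S̃ → S has kernel consisting of zerodivisors, then S̃ = S (the kernel of S̃ → S is zero). -/
/-!
STATEMENT 6: Let `R → S̃ → S` be surjective homomorphisms of commutative
noetherian local rings with `R → S̃` complete intersection, `S` of finite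
projective dimension over `S̃`, the induced map
`Ker(R→S̃)/m·Ker(R→S̃) → Ker(R→S)/m·Ker(R→S)` injective (expressed as
`Ker(R→S̃) ∩ m·Ker(R→S) ⊆ m·Ker(R→S̃)`), and `Ker(S̃→S)` consisting of
zerodivisors.  Then `S̃ = S`, i.e. `Ker(S̃ → S) = 0`.
-/

/-- A surjective homomorphism of local rings is complete intersection if its kernel
is generated by a regular sequence. -/
def RingHom.IsCompleteIntersection {R S : Type} [CommRing R] [CommRing S]
    (φ : R →+* S) : Prop :=
  ∃ rs : List R, RingTheory.Sequence.IsRegular R rs ∧ Ideal.ofList rs = RingHom.ker φ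

/-- Finite projective dimension via projective resolutions. -/
def HasFiniteProjectiveDimension (S : Type) [Ring S] (M : Type)
    [AddCommGroup M] [Module S M] : Prop :=
  ∃ (n : ℕ) (P : ChainComplex (ModuleCat S) ℕ)
    (f : P ⟶ (ChainComplex.single₀ (ModuleCat S)).obj (ModuleCat.of S M)),
      QuasiIso f ∧ (∀ i, CategoryTheory.Projective (P.X i)) ∧
        ∀ i, n < i → CategoryTheory.Limits.IsZero (P.X i)

section
open CategoryTheory

lemma hpd_lt (A M : Type) [CommRing A] [AddCommGroup M] [Module A M] (n : ℕ) (P : ChainComplex (ModuleCat A) ℕ)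
    (f : P ⟶ (ChainComplex.single₀ (ModuleCat A)).obj (ModuleCat.of A M))
    (hf : QuasiIso f) (hP : ∀ i, CategoryTheory.Projective (P.X i))
    (hz : ∀ i, n < i → CategoryTheory.Limits.IsZero (P.X i)) :
    HasProjectiveDimensionLT (ModuleCat.of A M) (n+1) := by
  let Q : ProjectiveResolution (ModuleCat.of A M) := { complex := P, projective := hP, π := f, quasiIso := hf }
  rw [hasProjectiveDimensionLT_iff.{0}]
  intro i hi Y e
  obtain ⟨g, hg, rfl⟩ := Q.extMk_surjective e (i+1) rfl
  have : g = 0 := (hz i hi).eq_of_src _ _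
  subst this
  simp

lemma depth0 {A F G H : Type} [CommRing A] [IsLocalRing A] [AddCommGroup F] [Module A F]
    [AddCommGroup G] [Module A G] [AddCommGroup H] [Module A H]
    [Module.Free A F] [Module.Finite A F] [Module.Free A G] [Module.Finite A G]
    (x : A) (hx : x ≠ 0) (hxm : ∀ a ∈ IsLocalRing.maximalIdeal A, a * x = 0)
    (f : F →ₗ[A] G) (g : G →ₗ[A] H) (hf : Function.Injective f) (hg : Function.Surjective g)
    (hfg : Function.Exact f g) :
    Module.Free A H ∧ Module.finrank A G = Module.finrank A F + Module.finrank A H := by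
  have key : ∀ v : F, x • v = 0 → v ∈ IsLocalRing.maximalIdeal A • (⊤ : Submodule A F) := by
    intro v hv
    let b := Module.Free.chooseBasis A F
    rw [← b.sum_repr v]
    refine Submodule.sum_mem _ fun i _ => Submodule.smul_mem_smul ?_ trivial
    have h1 : x * b.repr v i = 0 := by
      have := congrArg (fun w => b.repr w i) hv
      simpa using this
    by_contra hu
    have hu' : IsUnit (b.repr v i) := by simpa using hu
    exact hx (hu'.mul_left_eq_zero.mp h1)
  have key2 : ∀ w ∈ IsLocalRing.maximalIdeal A • (⊤ : Submodule A G), x • w = 0 := by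
    intro w hw
    refine Submodule.smul_induction_on hw (fun r hr m _ => ?_) (fun a b ha hb => ?_)
    · rw [smul_smul, mul_comm, hxm r hr, zero_smul]
    · rw [smul_add, ha, hb, add_zero]
  have kerF : ∀ v : F, (1 : IsLocalRing.ResidueField A) ⊗ₜ[A] v = 0 ↔
      v ∈ IsLocalRing.maximalIdeal A • (⊤ : Submodule A F) := by
    intro v; rw [← LinearMap.ker_tensorProductMk]; rfl
  have kerG : ∀ v : G, (1 : IsLocalRing.ResidueField A) ⊗ₜ[A] v = 0 ↔
      v ∈ IsLocalRing.maximalIdeal A • (⊤ : Submodule A G) := by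
    intro v; rw [← LinearMap.ker_tensorProductMk]; rfl
  have hinj : Function.Injective (f.lTensor (IsLocalRing.ResidueField A)) := by
    rw [injective_iff_map_eq_zero]
    intro z hz
    obtain ⟨v, rfl⟩ := TensorProduct.mk_surjective A F (IsLocalRing.ResidueField A)
      IsLocalRing.residue_surjective z
    simp only [TensorProduct.mk_apply, LinearMap.lTensor_tmul] at hz ⊢
    rw [kerG] at hz
    rw [kerF]
    apply key
    apply hf
    rw [map_smul, key2 _ hz, map_zero]
  have hfree : Module.Free A H := Module.free_of_lTensor_residueField_injective f g hg hfg hinj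
  refine ⟨hfree, ?_⟩
  have : Module.Finite A H := Module.Finite.of_surjective g hg
  obtain ⟨l, hl⟩ := Module.projective_lifting_property g LinearMap.id hg
  obtain ⟨e, he⟩ := Function.Exact.splitSurjectiveEquiv hfg hf ⟨l, hl⟩
  rw [e.finrank_eq, Module.finrank_prod]

lemma socle {A : Type} [CommRing A] [IsNoetherianRing A] (q : Ideal A) [q.IsPrime] (hq : q ∈ associatedPrimes A A) :
    ∃ x : Localization.AtPrime q, x ≠ 0 ∧ ∀ a ∈ IsLocalRing.maximalIdeal (Localization.AtPrime q), a * x = 0 := by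
  have h := Module.associatedPrimes.mem_associatedPrimes_of_comap_mem_associatedPrimes_of_isLocalizedModule
    (R' := Localization.AtPrime q) q.primeCompl (Algebra.linearMap A (Localization.AtPrime q))
    (IsLocalRing.maximalIdeal (Localization.AtPrime q))
    (by simpa [Localization.AtPrime.under_maximalIdeal] using hq)
  rw [AssociatedPrimes.mem_iff, isAssociatedPrime_iff] at h
  obtain ⟨hp, x, hx⟩ := h
  refine ⟨x, ?_, ?_⟩
  · rintro rfl
    apply hp.ne_top
    rw [hx]; simp
  · intro a ha
    rw [hx, Submodule.mem_colon_singleton] at ha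
    simpa using ha

lemma constRank {A : Type} [CommRing A] [IsNoetherianRing A] [IsLocalRing A] (n : ℕ)
    (M : Type) [AddCommGroup M] [Module A M] [Module.Finite A M]
    (h : HasProjectiveDimensionLT (ModuleCat.of A M) (n+1)) :
    ∃ r : ℕ, ∀ (q : Ideal A) [q.IsPrime], q ∈ associatedPrimes A A →
      Module.Free (Localization.AtPrime q) (LocalizedModule q.primeCompl M) ∧
      Module.finrank (Localization.AtPrime q) (LocalizedModule q.primeCompl M) = r := by
  induction n generalizing M with
  | zero =>
    rw [zero_add, ← projective_iff_hasProjectiveDimensionLT_one, ← IsProjective.iff_projective] at h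
    have : Module.Projective A M := h
    have : Module.Free A M := Module.free_of_flat_of_isLocalRing
    refine ⟨Module.finrank A M, fun q _ _ => ⟨?_, ?_⟩⟩
    · exact Module.free_of_isLocalizedModule q.primeCompl (LocalizedModule.mkLinearMap q.primeCompl M)
    · exact Module.finrank_of_isLocalizedModule_of_free _ q.primeCompl (LocalizedModule.mkLinearMap q.primeCompl M)
  | succ n ih =>
    obtain ⟨P, _, _, _, _, f, surjf⟩ := Module.exists_finite_presentation A M
    have S_exact := LinearMap.shortExact_shortComplexKer surjf
    have proj : Projective (ModuleCat.of A P) := ModuleCat.projective_of_categoryTheory_projective _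
    have hK := (S_exact.hasProjectiveDimensionLT_X₃_iff n proj).mp h
    obtain ⟨r, hr⟩ := ih (LinearMap.ker f) hK
    refine ⟨Module.finrank A P - r, fun q _ hq => ?_⟩
    obtain ⟨h1, h2⟩ := hr q hq
    obtain ⟨x, hx, hxm⟩ := socle q hq
    have hP1 : Module.Free (Localization.AtPrime q) (LocalizedModule q.primeCompl P) :=
      Module.free_of_isLocalizedModule q.primeCompl (LocalizedModule.mkLinearMap q.primeCompl P)
    have hP2 : Module.finrank (Localization.AtPrime q) (LocalizedModule q.primeCompl P) = Module.finrank A P :=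
      Module.finrank_of_isLocalizedModule_of_free _ q.primeCompl (LocalizedModule.mkLinearMap q.primeCompl P)
    have := depth0 x hx hxm (LocalizedModule.map q.primeCompl (LinearMap.ker f).subtype)
      (LocalizedModule.map q.primeCompl f)
      (LocalizedModule.map_injective _ _ (Submodule.injective_subtype _))
      (LocalizedModule.map_surjective _ _ surjf)
      (LocalizedModule.map_exact _ _ _ (LinearMap.exact_subtype_ker_map f))
    refine ⟨this.1, ?_⟩
    omega

lemma faithful_loc {A : Type} [CommRing A] (I : Ideal A) (M : Type) [AddCommGroup M] [Module A M]
    (hI : ∀ i ∈ I, ∀ m : M, i • m = 0) (q : Ideal A) [q.IsPrime]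
    (hfree : Module.Free (Localization.AtPrime q) (LocalizedModule q.primeCompl M))
    (hnt : Nontrivial (LocalizedModule q.primeCompl M)) (i : A) (hi : i ∈ I) :
    ∃ s ∉ q, s * i = 0 := by
  have h0 : algebraMap A (Localization.AtPrime q) i = 0 := by
    have : algebraMap A (Localization.AtPrime q) i ∈
      Module.annihilator (Localization.AtPrime q) (LocalizedModule q.primeCompl M) := by
      rw [Module.mem_annihilator]
      intro m
      induction m using LocalizedModule.induction_on with
      | h m s => rw [algebraMap_smul, LocalizedModule.smul'_mk, hI i hi, LocalizedModule.zero_mk]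
    rwa [Module.annihilator_eq_bot.mpr inferInstance, Ideal.mem_bot] at this
  rw [IsLocalization.map_eq_zero_iff q.primeCompl] at h0
  obtain ⟨s, hs⟩ := h0
  exact ⟨s, s.2, hs⟩

lemma ideal_eq_bot {A : Type} [CommRing A] [IsNoetherianRing A] [IsLocalRing A] (I : Ideal A) (n : ℕ)
    (M : Type) [AddCommGroup M] [Module A M] (m0 : M) (hm0 : ∀ m : M, ∃ a : A, m = a • m0)
    (hIM : ∀ i, i ∈ I ↔ i • m0 = 0)
    (h : HasProjectiveDimensionLT (ModuleCat.of A M) (n+1))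
    (hzd : ∀ x ∈ I, x ∉ nonZeroDivisors A) : I = ⊥ := by
  have hfin : Module.Finite A M := ⟨⟨{m0}, by
    rw [eq_top_iff]
    intro m _
    obtain ⟨a, rfl⟩ := hm0 m
    exact Submodule.smul_mem _ _ (Submodule.subset_span (by simp))⟩⟩
  have hI : ∀ i ∈ I, ∀ m : M, i • m = 0 := by
    intro i hi m
    obtain ⟨a, rfl⟩ := hm0 m
    rw [smul_comm, (hIM i).1 hi, smul_zero]
  obtain ⟨r, hr⟩ := constRank n M h
  obtain ⟨p, hp, hIp⟩ : ∃ P ∈ associatedPrimes A A, I ≤ P :=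
    (I.subset_union_prime_finite (associatedPrimes.finite ..) (f := id) 0 0 fun _ h _ _ ↦ h.1).1 <|
    biUnion_associatedPrimes_eq_compl_nonZeroDivisors A ▸ hzd
  have : p.IsPrime := hp.1
  have hnt : Nontrivial (LocalizedModule p.primeCompl M) := by
    refine ⟨LocalizedModule.mk m0 1, 0, fun h => ?_⟩
    rw [← LocalizedModule.zero_mk 1, LocalizedModule.mk_eq] at h
    obtain ⟨u, hu⟩ := h
    have : (u : A) • m0 = 0 := by simpa using! hu
    exact u.2 (hIp ((hIM _).2 this))
  have hr0 : 0 < r := by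
    obtain ⟨h1, h2⟩ := hr p hp
    rw [← h2]
    exact Module.finrank_pos_iff_of_free _ _ |>.mpr hnt
  rw [eq_bot_iff]
  intro i hi
  by_contra hne
  obtain ⟨q, hq, hle⟩ := exists_le_isAssociatedPrime_of_isNoetherianRing A i hne
  have : q.IsPrime := hq.1
  obtain ⟨h1, h2⟩ := hr q hq
  have hnt' : Nontrivial (LocalizedModule q.primeCompl M) :=
    (Module.finrank_pos_iff_of_free (Localization.AtPrime q) _).mp (h2 ▸ hr0)
  obtain ⟨s, hs, hsi⟩ := faithful_loc I M hI q h1 hnt' i hi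
  exact hs (hle (by rw [Submodule.mem_colon_singleton]; simpa using hsi))

end

theorem factorization_kernel_is_zero
    (R Stilde S : Type) [CommRing R] [CommRing Stilde] [CommRing S]
    [IsNoetherianRing R] [IsNoetherianRing Stilde] [IsNoetherianRing S]
    [IsLocalRing R] [IsLocalRing Stilde] [IsLocalRing S]
    (φt : R →+* Stilde) (φd : Stilde →+* S)
    (hφts : Function.Surjective φt) (hφds : Function.Surjective φd)
    (hφtl : IsLocalHom φt) (hφdl : IsLocalHom φd)
    -- `R → S̃` is complete intersection
    (hci : φt.IsCompleteIntersection)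
    -- `S` has finite projective dimension over `S̃`
    (hpd : letI := φd.toAlgebra; HasFiniteProjectiveDimension Stilde S)
    -- injectivity of `Ker φ̃ / m Ker φ̃ → Ker φ / m Ker φ`
    (hinj : RingHom.ker φt ⊓
        (IsLocalRing.maximalIdeal R * RingHom.ker (φd.comp φt)) ≤
        IsLocalRing.maximalIdeal R * RingHom.ker φt)
    -- the kernel of `S̃ → S` consists of zerodivisors
    (hzd : ∀ x ∈ RingHom.ker φd, x ∉ nonZeroDivisors Stilde) :
    RingHom.ker φd = ⊥ := by
  let := φd.toAlgebra
  obtain ⟨n, P, f, h1, h2, h3⟩ := hpd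
  refine ideal_eq_bot _ n S 1 (fun m => ?_) (fun i => ?_) (hpd_lt _ _ n P f h1 h2 h3) hzd
  · obtain ⟨a, rfl⟩ := hφds m
    exact ⟨a, by rw [Algebra.smul_def, mul_one]; rfl⟩
  · rw [Algebra.smul_def, mul_one, RingHom.mem_ker]; rfl
end

section
/- Let R → S → T be surjective homomorphisms of commutative noetherian local rings such that the composite R → T is complete intersection (kernel generated by a regular sequence) and T has finite projective dimension over S. Then both R → S and S → T are complete intersection. -/
namespace AvramovFactor

open TensorProduct

/-- The comparison `B → E` of differential modules becomes zero in homology after tensoring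
with `M`. -/
def ZeroOn {S : Type} [CommRing S] {B E : Type} [AddCommGroup B] [Module S B]
    [AddCommGroup E] [Module S E] (DB : B →ₗ[S] B) (DE : E →ₗ[S] E) (c : B →ₗ[S] E)
    (M : Type) [AddCommGroup M] [Module S M] : Prop :=
  ∀ z : M ⊗[S] B, DB.lTensor M z = 0 → ∃ w, DE.lTensor M w = c.lTensor M z

section
variable {S : Type} [CommRing S] {B E : Type} [AddCommGroup B] [Module S B]
    [AddCommGroup E] [Module S E] {DB : B →ₗ[S] B} {DE : E →ₗ[S] E} {c : B →ₗ[S] E}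

lemma ZeroOn.step [Module.Flat S B] (hDB : DB ∘ₗ DB = 0) (hE : Function.Exact DE DE)
    (hc : c ∘ₗ DB = DE ∘ₗ c)
    {M' P M : Type} [AddCommGroup M'] [Module S M'] [AddCommGroup P] [Module S P]
    [AddCommGroup M] [Module S M] [Module.Flat S P] (f : M' →ₗ[S] P) (g : P →ₗ[S] M)
    (hf : Function.Injective f) (hfg : Function.Exact f g) (hg : Function.Surjective g)
    (h : ZeroOn DB DE c M') : ZeroOn DB DE c M := by
  intro z hz
  obtain ⟨w, rfl⟩ := LinearMap.rTensor_surjective B hg z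
  have hex := rTensor_exact B hfg hg
  have h1 : g.rTensor B (DB.lTensor P w) = 0 := by
    rw [← hz, ← LinearMap.comp_apply, ← LinearMap.comp_apply, LinearMap.rTensor_comp_lTensor,
      LinearMap.lTensor_comp_rTensor]
  obtain ⟨v, hv⟩ := (hex _).1 h1
  have hinj : Function.Injective (f.rTensor B) := Module.Flat.rTensor_preserves_injective_linearMap f hf
  have hDv : DB.lTensor M' v = 0 := by
    apply hinj
    rw [map_zero, ← LinearMap.comp_apply, LinearMap.rTensor_comp_lTensor,
      ← LinearMap.lTensor_comp_rTensor, LinearMap.comp_apply, hv, ← LinearMap.comp_apply,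
      ← LinearMap.lTensor_comp, hDB]
    simp
  obtain ⟨e, he⟩ := h v hDv
  have hexP : Function.Exact (DE.lTensor P) (DE.lTensor P) := Module.Flat.lTensor_exact P hE
  have h2 : DE.lTensor P (c.lTensor P w - f.rTensor E e) = 0 := by
    rw [map_sub, sub_eq_zero]
    calc DE.lTensor P (c.lTensor P w) = c.lTensor P (DB.lTensor P w) := by
          rw [← LinearMap.comp_apply, ← LinearMap.comp_apply, ← LinearMap.lTensor_comp,
            ← LinearMap.lTensor_comp, hc]
      _ = f.rTensor E (c.lTensor M' v) := by
          rw [← hv, ← LinearMap.comp_apply, ← LinearMap.comp_apply,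
            LinearMap.rTensor_comp_lTensor, LinearMap.lTensor_comp_rTensor]
      _ = DE.lTensor P (f.rTensor E e) := by
          rw [← he, ← LinearMap.comp_apply, ← LinearMap.comp_apply,
            LinearMap.rTensor_comp_lTensor, LinearMap.lTensor_comp_rTensor]
  obtain ⟨u, hu⟩ := (hexP _).1 h2
  refine ⟨g.rTensor E u, ?_⟩
  have h3 : DE.lTensor M (g.rTensor E u) = g.rTensor E (DE.lTensor P u) := by
    rw [← LinearMap.comp_apply, ← LinearMap.comp_apply,
            LinearMap.rTensor_comp_lTensor, LinearMap.lTensor_comp_rTensor]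
  have h4 : g.rTensor E (f.rTensor E e) = 0 := (rTensor_exact E hfg hg).apply_apply_eq_zero e
  rw [h3, hu, map_sub, h4, sub_zero, ← LinearMap.comp_apply, ← LinearMap.comp_apply,
            LinearMap.rTensor_comp_lTensor, LinearMap.lTensor_comp_rTensor]

lemma ZeroOn.of_subsingleton (M : Type) [AddCommGroup M] [Module S M] [Subsingleton M] :
    ZeroOn DB DE c M := by
  intro z _
  have : Subsingleton (M ⊗[S] E) := inferInstance
  exact ⟨0, Subsingleton.elim _ _⟩

open CategoryTheory in
lemma ZeroOn.of_finite [Module.Flat S B] (hDB : DB ∘ₗ DB = 0) (hE : Function.Exact DE DE)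
    (hc : c ∘ₗ DB = DE ∘ₗ c) (M : Type) [AddCommGroup M] [Module S M]
    (hM : HasFiniteProjectiveDimension S M) : ZeroOn DB DE c M := by
  obtain ⟨n, P, f, hq, hP, hz⟩ := hM
  let Q : ProjectiveResolution (ModuleCat.of S M) :=
    { complex := P, projective := hP, π := f, quasiIso := hq }
  have hflat : ∀ i, Module.Flat S (P.X i) := fun i => by
    have := hP i
    have : Module.Projective S (P.X i) := (IsProjective.iff_projective _).2 (hP i)
    infer_instance
  have hex : ∀ i, Function.Exact (P.d (i+2) (i+1)).hom (P.d (i+1) i).hom := fun i =>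
    (ShortComplex.ShortExact.moduleCat_exact_iff_function_exact _).1 (Q.exact_succ i)
  have key : ∀ k i, n < i + k → ZeroOn DB DE c (P.X i ⧸ LinearMap.range (P.d (i+1) i).hom) := by
    intro k
    induction k with
    | zero =>
      intro i hi
      have := ModuleCat.subsingleton_of_isZero (hz i hi)
      exact ZeroOn.of_subsingleton _
    | succ k ih =>
      intro i hi
      have h1 := ih (i+1) (by omega)
      have hker : LinearMap.range (P.d (i+1+1) (i+1)).hom = LinearMap.ker (P.d (i+1) i).hom :=
        (LinearMap.exact_iff.1 (hex i)).symm
      refine ZeroOn.step hDB hE hc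
        (Submodule.liftQ _ (P.d (i+1) i).hom hker.le) (Submodule.mkQ _) ?_ ?_
        (Submodule.mkQ_surjective _) h1
      · rw [← LinearMap.ker_eq_bot]
        exact Submodule.ker_liftQ_eq_bot _ _ _ hker.ge
      · rw [LinearMap.exact_iff, Submodule.ker_mkQ, Submodule.range_liftQ]
  have hker : LinearMap.range (P.d (0+1+1) (0+1)).hom = LinearMap.ker (P.d (0+1) 0).hom :=
        (LinearMap.exact_iff.1 (hex 0)).symm
  have h0 : ∃ f0 : P.X 0 →ₗ[S] M, Function.Exact (P.d 1 0).hom f0 ∧ Function.Surjective f0 := by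
    have hepi : ∀ Q' : ProjectiveResolution (ModuleCat.of S M), Epi (Q'.π.f 0) :=
      fun _ => inferInstance
    have : Epi (f.f 0) := hepi Q
    exact ⟨(f.f 0).hom,
      (ShortComplex.ShortExact.moduleCat_exact_iff_function_exact _).1 Q.exact₀,
      (ModuleCat.epi_iff_surjective (f.f 0)).1 this⟩
  obtain ⟨f0, hex0, hsurj⟩ := h0
  refine ZeroOn.step (M := M) hDB hE hc
    (Submodule.liftQ _ (P.d 1 0).hom hker.le) f0 ?_ ?_ hsurj (key n (0+1) (by omega))
  · rw [← LinearMap.ker_eq_bot]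
    exact Submodule.ker_liftQ_eq_bot _ _ _ hker.ge
  · rw [LinearMap.exact_iff, Submodule.range_liftQ]
    exact LinearMap.exact_iff.1 hex0

end

/-- Matrix-factorization-like data. -/
def HasFactor {S : Type} [CommRing S] {N : Type} [AddCommGroup N] [Module S N]
    (p : N →ₗ[S] S) (K : Ideal S) (γ : N) : Prop :=
  ∃ (F : Type) (_ : AddCommGroup F) (_ : Module S F) (_ : Module.Free S F)
    (D : F →ₗ[S] F) (e : F) (ψ₀ : F →ₗ[S] S) (ψ₁ : F →ₗ[S] N),
    (∀ x, D (D x) = p γ • x) ∧ D e ∈ K • (⊤ : Submodule S F) ∧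
    (∀ x, ψ₀ (D x) = p (ψ₁ x)) ∧ (∀ x, ψ₁ (D x) = ψ₀ x • γ) ∧ ψ₀ e = 1 ∧ ψ₁ e = 0

section
variable {S : Type} [CommRing S] {N : Type} [AddCommGroup N] [Module S N]
    {p : N →ₗ[S] S} {K : Ideal S}

lemma HasFactor.zero : HasFactor p K 0 :=
  ⟨S, inferInstance, inferInstance, inferInstance, 0, 1, LinearMap.id, 0,
    by simp, by simp, by simp, by simp, by simp, by simp⟩

lemma HasFactor.add_smul (hp : ∀ n n', p n • n' = p n' • n) {γ : N} (h : HasFactor p K γ)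
    {b : S} (hb : b ∈ K) (α : N) : HasFactor p K (γ + b • α) := by
  obtain ⟨F, _, _, _, D, e, ψ₀, ψ₁, h1, h2, h3, h4, h5, h6⟩ := h
  refine ⟨F × F, inferInstance, inferInstance, inferInstance,
    LinearMap.prod (D ∘ₗ LinearMap.fst S F F + p α • LinearMap.snd S F F)
      (b • LinearMap.fst S F F - D ∘ₗ LinearMap.snd S F F), (e, 0),
    ψ₀ ∘ₗ LinearMap.fst S F F,
    ψ₁ ∘ₗ LinearMap.fst S F F + (LinearMap.toSpanSingleton S N α) ∘ₗ ψ₀ ∘ₗ LinearMap.snd S F F,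
    ?_, ?_, ?_, ?_, ?_, ?_⟩
  · rintro ⟨x, y⟩
    ext
    · simp [h1, smul_sub, smul_smul, mul_comm]
      module
    · simp [h1, smul_sub, smul_smul, mul_comm]
      module
  · have : (LinearMap.prod (D ∘ₗ LinearMap.fst S F F + p α • LinearMap.snd S F F)
      (b • LinearMap.fst S F F - D ∘ₗ LinearMap.snd S F F)) (e, 0) =
        LinearMap.inl S F F (D e) + b • LinearMap.inr S F F e := by
      ext <;> simp
    rw [this]
    refine add_mem ?_ (Submodule.smul_mem_smul hb trivial)
    have := Submodule.mem_map_of_mem (f := LinearMap.inl S F F) h2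
    rw [Submodule.map_smul''] at this
    exact Submodule.smul_mono le_rfl le_top this
  · rintro ⟨x, y⟩
    simp [h3, mul_comm]
  · rintro ⟨x, y⟩
    have := hp α (ψ₁ y)
    simp [h4, h3, sub_smul, smul_smul, this, mul_comm]
  · simpa using h5
  · simpa using h6

lemma HasFactor.of_mem (hp : ∀ n n', p n • n' = p n' • n) {γ : N}
    (hγ : γ ∈ K • (⊤ : Submodule S N)) : HasFactor p K γ := by
  have : ∀ γ₀, HasFactor p K γ₀ → HasFactor p K (γ₀ + γ) := by
    refine Submodule.smul_induction_on hγ ?_ ?_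
    · intro b hb n _ γ₀ h
      exact h.add_smul hp hb n
    · intro x y hx hy γ₀ h
      rw [← add_assoc]
      exact hy _ (hx _ h)
  simpa using this 0 HasFactor.zero

lemma not_finite_pd (hp : ∀ n n', p n • n' = p n' • n) {γ : N}
    (hker : ∀ n, p n = 0 → ∃ s : S, s • γ = n) (hγ0 : p γ = 0)
    (hann : ∀ s : S, s • γ = 0 ↔ ∃ n, p n = s)
    (hγ : γ ∈ K • (⊤ : Submodule S N))
    (T : Type) [CommRing T] [Algebra S T] (hK : ∀ s ∈ K, algebraMap S T s = 0)
    (𝔪 : Ideal T) (h𝔪 : 𝔪 ≠ ⊤) (hpm : ∀ n, algebraMap S T (p n) ∈ 𝔪)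
    (hfin : HasFiniteProjectiveDimension S T) : False := by
  obtain ⟨F, _, _, _, D, e, ψ₀, ψ₁, h1, h2, h3, h4, h5, h6⟩ := HasFactor.of_mem hp hγ
  let DE : (S × N) →ₗ[S] (S × N) := LinearMap.prod (p ∘ₗ LinearMap.snd S S N)
    ((LinearMap.toSpanSingleton S N γ) ∘ₗ LinearMap.fst S S N)
  have hDE : ∀ s n, DE (s, n) = (p n, s • γ) := fun s n => by simp [DE]
  have hE : Function.Exact DE DE := by
    rintro ⟨s, n⟩
    rw [hDE]
    constructor
    · intro h
      simp only [Prod.mk_eq_zero] at h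
      obtain ⟨s', hs'⟩ := hker n h.1
      obtain ⟨n', hn'⟩ := (hann s).1 h.2
      exact ⟨(s', n'), by rw [hDE, hs', hn']⟩
    · rintro ⟨⟨s', n'⟩, h⟩
      rw [hDE, Prod.mk.injEq] at h
      rw [← h.1, ← h.2, (hann _).2 ⟨_, rfl⟩]
      simp [hγ0]
  have hz := ZeroOn.of_finite (DB := D) (DE := DE) (c := LinearMap.prod ψ₀ ψ₁)
    (by ext x; simp [h1, hγ0]) hE
    (by
      refine LinearMap.ext fun x => ?_
      show (ψ₀ (D x), ψ₁ (D x)) = DE (ψ₀ x, ψ₁ x)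
      rw [hDE, h3, h4]) T hfin
  have hcyc : D.lTensor T ((1 : T) ⊗ₜ[S] e) = 0 := by
    rw [LinearMap.lTensor_tmul]
    refine Submodule.smul_induction_on (p := fun x => (1 : T) ⊗ₜ[S] x = 0) h2 ?_ ?_
    · intro r hr n _
      rw [← smul_tmul, Algebra.smul_def, hK r hr, zero_mul, zero_tmul]
    · intro x y hx hy
      rw [tmul_add, hx, hy, add_zero]
  obtain ⟨w, hw⟩ := hz _ hcyc
  have := congrArg (fun v => TensorProduct.rid S T ((LinearMap.fst S S N).lTensor T v)) hw
  have h7 : LinearMap.prod ψ₀ ψ₁ e = (1, 0) := by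
    rw [← h5, ← h6]
    rfl
  simp only [LinearMap.lTensor_tmul, h7, LinearMap.fst_apply, TensorProduct.rid_tmul,
    one_smul] at this
  apply h𝔪
  rw [Ideal.eq_top_iff_one, ← this]
  clear this hw
  induction w with
  | zero => simp
  | add x y hx hy => simpa only [map_add] using add_mem hx hy
  | tmul t x =>
    obtain ⟨s, n⟩ := x
    simp only [LinearMap.lTensor_tmul, hDE, LinearMap.fst_apply, TensorProduct.rid_tmul]
    rw [Algebra.smul_def]
    exact Ideal.mul_mem_right _ _ (hpm n)

end

section

lemma exists_hyperplane {R : Type} [CommRing R] [IsNoetherianRing R] (I L₀ : Ideal R)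
    (h : L₀ < I) : ∃ L : Ideal R, L₀ ≤ L ∧ L ≤ I ∧ ∃ g ∈ I, g ∉ L ∧
      ∀ x ∈ I, ∃ r : R, x - r * g ∈ L := by
  obtain ⟨L, ⟨h1, h2⟩, hmax⟩ := WellFounded.has_min
    (r := ((· > ·) : Ideal R → Ideal R → Prop)) wellFounded_gt
    {L : Ideal R | L₀ ≤ L ∧ L < I} ⟨L₀, le_rfl, h⟩
  obtain ⟨g, hg, hgL⟩ := SetLike.exists_of_lt h2
  refine ⟨L, h1, h2.le, g, hg, hgL, fun x hx => ?_⟩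
  have h3 : L < L ⊔ Ideal.span {g} := by
    refine lt_of_le_of_ne le_sup_left fun h => hgL ?_
    rw [h]
    exact Ideal.mem_sup_right (Ideal.mem_span_singleton_self g)
  have h4 : L ⊔ Ideal.span {g} ≤ I := sup_le h2.le (by simpa [Ideal.span_le] using hg)
  have h5 : L ⊔ Ideal.span {g} = I := by
    by_contra hne
    exact hmax _ ⟨h1.trans h3.le, lt_of_le_of_ne h4 hne⟩ h3
  rw [← h5] at hx
  obtain ⟨l, hl, y, hy, rfl⟩ := Submodule.mem_sup.1 hx
  obtain ⟨r, rfl⟩ := Ideal.mem_span_singleton'.1 hy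
  exact ⟨r, by simpa using hl⟩

open IsLocalRing in
lemma ker_eq_bot_of_le {R S T : Type} [CommRing R] [CommRing S] [CommRing T]
    [IsNoetherianRing R] [IsLocalRing R] [IsLocalRing S] [IsLocalRing T]
    (φ : R →+* S) (ψ : S →+* T) (hφs : Function.Surjective φ)
    (hloc : IsLocalHom (ψ.comp φ))
    (hpd : letI := ψ.toAlgebra; HasFiniteProjectiveDimension S T)
    (hle : RingHom.ker φ ≤ maximalIdeal R * RingHom.ker (ψ.comp φ)) : RingHom.ker φ = ⊥ := by
  by_contra hne
  set I := RingHom.ker φ with hI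
  have hIm : I ≤ maximalIdeal R := hle.trans Ideal.mul_le_left
  have hlt : maximalIdeal R * I < I := by
    refine lt_of_le_of_ne Ideal.mul_le_right fun h => hne ?_
    refine Submodule.eq_bot_of_le_smul_of_le_jacobson_bot (maximalIdeal R) I
      (IsNoetherian.noetherian I) h.ge (maximalIdeal_le_jacobson _)
  obtain ⟨L, hL0, hLI, g, hgI, hgL, hgen⟩ := exists_hyperplane I _ hlt
  let N := maximalIdeal R ⧸ (Submodule.comap (maximalIdeal R).subtype L)
  have hmk : ∀ x : maximalIdeal R,
      (Submodule.Quotient.mk x : N) = 0 ↔ (x : R) ∈ L := fun x => by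
    rw [Submodule.Quotient.mk_eq_zero]; rfl
  have hkill : RingHom.ker φ ≤ RingHom.ker (Module.toAddMonoidEnd R N) := by
    intro r hr
    rw [RingHom.mem_ker]
    ext n
    obtain ⟨x, rfl⟩ := Submodule.Quotient.mk_surjective _ n
    show r • (Submodule.Quotient.mk x : N) = 0
    rw [← Submodule.Quotient.mk_smul, hmk]
    refine hL0 ?_
    rw [Submodule.coe_smul, smul_eq_mul, mul_comm (r : R) (x : R)]
    exact Ideal.mul_mem_mul x.2 hr
  let θ : S →+* AddMonoid.End N := φ.liftOfSurjective hφs ⟨Module.toAddMonoidEnd R N, hkill⟩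
  have hθ : ∀ r, θ (φ r) = Module.toAddMonoidEnd R N r := fun r =>
    RingHom.liftOfRightInverse_comp_apply _ _ _ _ _
  let : Module S N := Module.compHom N θ
  have hsm : ∀ (r : R) (n : N), φ r • n = r • n := fun r n =>
    congrArg (fun F : AddMonoid.End N => F n) (hθ r)
  let : Algebra R S := φ.toAlgebra
  let p₀ : N →ₗ[R] S := Submodule.liftQ _ (Algebra.linearMap R S ∘ₗ (maximalIdeal R).subtype) (by
    intro x hx
    exact hLI hx)
  let p : N →ₗ[S] S :=
    { toFun := p₀
      map_add' := map_add p₀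
      map_smul' := by
        intro s n
        obtain ⟨r, rfl⟩ := hφs s
        rw [hsm, map_smul]
        exact Algebra.smul_def r (p₀ n) }
  have hp : ∀ x : maximalIdeal R, p (Submodule.Quotient.mk x : N) = φ x := fun x => rfl
  let := ψ.toAlgebra
  refine not_finite_pd (p := p) (K := RingHom.ker ψ)
    (γ := (Submodule.Quotient.mk ⟨g, hIm hgI⟩ : N)) ?_ ?_ ?_ ?_ ?_ T (fun s hs => hs)
    (maximalIdeal T) (Ideal.IsPrime.ne_top inferInstance) ?_ hpd
  · intro n n'
    obtain ⟨x, rfl⟩ := Submodule.Quotient.mk_surjective _ n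
    obtain ⟨y, rfl⟩ := Submodule.Quotient.mk_surjective _ n'
    rw [hp, hp, hsm, hsm, ← Submodule.Quotient.mk_smul, ← Submodule.Quotient.mk_smul]
    congr 1
    ext
    simp [mul_comm]
  · intro n hn
    obtain ⟨x, rfl⟩ := Submodule.Quotient.mk_surjective _ n
    rw [hp] at hn
    obtain ⟨r, hr⟩ := hgen x hn
    refine ⟨φ r, ?_⟩
    rw [hsm, ← Submodule.Quotient.mk_smul, eq_comm, Submodule.Quotient.eq]
    exact hr
  · rw [hp]
    exact hgI
  · intro s
    constructor
    · intro hs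
      obtain ⟨r, rfl⟩ := hφs s
      rw [hsm, ← Submodule.Quotient.mk_smul, hmk] at hs
      have hr : r ∈ maximalIdeal R := by
        by_contra hr
        have hu : IsUnit r := by simpa using hr
        exact hgL ((Ideal.unit_mul_mem_iff_mem L hu).1 hs)
      exact ⟨Submodule.Quotient.mk ⟨r, hr⟩, rfl⟩
    · rintro ⟨n, rfl⟩
      obtain ⟨x, rfl⟩ := Submodule.Quotient.mk_surjective _ n
      rw [hp, hsm, ← Submodule.Quotient.mk_smul, hmk]
      exact hL0 (Ideal.mul_mem_mul x.2 hgI)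
  · have key : ∀ y ∈ maximalIdeal R * RingHom.ker (ψ.comp φ), ∃ hy : y ∈ maximalIdeal R,
        (Submodule.Quotient.mk ⟨y, hy⟩ : N) ∈ RingHom.ker ψ • (⊤ : Submodule S N) := by
      intro y hy
      refine Submodule.mul_induction_on hy ?_ ?_
      · intro m hm j hj
        have hy : m * j ∈ maximalIdeal R := Ideal.mul_mem_right _ _ hm
        refine ⟨hy, ?_⟩
        have : (Submodule.Quotient.mk ⟨m * j, hy⟩ : N)
            = φ j • (Submodule.Quotient.mk ⟨m, hm⟩ : N) := by
          rw [hsm, ← Submodule.Quotient.mk_smul]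
          congr 1
          ext
          simp [mul_comm]
        rw [this]
        exact Submodule.smul_mem_smul (by simpa using hj) trivial
      · rintro x y ⟨hxm, hx⟩ ⟨hym, hy⟩
        exact ⟨add_mem hxm hym, add_mem hx hy⟩
    exact (key g (hle hgI)).2
  · intro n
    obtain ⟨x, rfl⟩ := Submodule.Quotient.mk_surjective _ n
    rw [hp]
    exact mt (hloc.map_nonunit (x : R)) x.2
end
section
open IsLocalRing RingTheory.Sequence
open scoped Pointwise

lemma exchange_aux {R : Type} [CommRing R] [IsLocalRing R] (rs : List R) :
    ∀ u ∈ Ideal.ofList rs, u ∈ maximalIdeal R * Ideal.ofList rs ∨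
      ∃ (x : R) (l : List R) (c : R), List.Perm rs (x :: l) ∧ IsUnit c ∧
        u - c * x ∈ Ideal.ofList l := by
  induction rs with
  | nil =>
    intro u hu
    left
    simpa using hu
  | cons y ys ih =>
    intro u hu
    rw [Ideal.ofList_cons] at hu
    obtain ⟨w, hw, v, hv, rfl⟩ := Submodule.mem_sup.1 hu
    obtain ⟨a, rfl⟩ := Ideal.mem_span_singleton'.1 hw
    by_cases ha : IsUnit a
    · right
      exact ⟨y, ys, a, List.Perm.refl _, ha, by simpa using hv⟩
    · rcases ih v hv with h | ⟨x, l, c, hperm, hc, hx⟩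
      · left
        rw [Ideal.ofList_cons, Ideal.mul_sup]
        exact Submodule.add_mem_sup
          (Ideal.mul_mem_mul ha (Ideal.mem_span_singleton_self y)) h
      · right
        refine ⟨x, y :: l, c, (hperm.cons y).trans (List.Perm.swap _ _ _), hc, ?_⟩
        rw [Ideal.ofList_cons, add_sub_assoc]
        exact Submodule.add_mem_sup hw hx

lemma ofList_perm {R : Type} [CommRing R] {l l' : List R} (h : List.Perm l l') :
    Ideal.ofList l = Ideal.ofList l' :=
  congrArg Ideal.span (Set.ext fun _ => h.mem_iff)

lemma exchange {R : Type} [CommRing R] [IsLocalRing R] [IsNoetherianRing R] (rs : List R)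
    (hrs : IsRegular R rs) (u : R) (hu : u ∈ Ideal.ofList rs)
    (hu' : u ∉ maximalIdeal R * Ideal.ofList rs) :
    ∃ l : List R, rs.length = l.length + 1 ∧ IsRegular R (u :: l) ∧
      Ideal.ofList (u :: l) = Ideal.ofList rs := by
  obtain ⟨x, l, c, hperm, hc, hx⟩ := (exchange_aux rs u hu).resolve_left hu'
  have hspan : Ideal.ofList (u :: l) = Ideal.ofList rs := by
    rw [ofList_perm hperm]
    have hux : u = c * x + (u - c * x) := by ring
    obtain ⟨c, rfl⟩ := hc
    have hxu : x = (↑c⁻¹ : R) * u - (↑c⁻¹ : R) * (u - c * x) := by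
      rw [mul_sub, ← mul_assoc, Units.inv_mul]; ring
    apply le_antisymm
    · rw [Ideal.ofList_cons, Ideal.ofList_cons]
      refine sup_le ?_ le_sup_right
      rw [Ideal.span_singleton_le_iff_mem, hux]
      exact Submodule.add_mem_sup (Ideal.mul_mem_left _ _ (Ideal.mem_span_singleton_self x)) hx
    · rw [Ideal.ofList_cons, Ideal.ofList_cons]
      refine sup_le ?_ le_sup_right
      rw [Ideal.span_singleton_le_iff_mem, hxu]
      refine sub_mem (Ideal.mem_sup_left (Ideal.mul_mem_left _ _ (Ideal.mem_span_singleton_self u)))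
        (Ideal.mem_sup_right (Ideal.mul_mem_left _ _ hx))
  refine ⟨l, by simpa using hperm.length_eq, ?_, hspan⟩
  have hreg : IsRegular R (l ++ [x]) := isRegular_of_perm hrs
    (hperm.trans (List.perm_append_singleton x l).symm)
  have hw := hreg.toIsWeaklyRegular
  rw [isWeaklyRegular_append_iff, isWeaklyRegular_singleton_iff] at hw
  have hw' : IsWeaklyRegular R (l ++ [u]) := by
    rw [isWeaklyRegular_append_iff, isWeaklyRegular_singleton_iff]
    refine ⟨hw.1, ?_⟩
    intro a b hab
    apply hw.2
    have hact : ∀ a : R ⧸ (Ideal.ofList l • ⊤ : Submodule R R), u • a = c • x • a := by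
      intro a
      obtain ⟨a, rfl⟩ := Submodule.Quotient.mk_surjective _ a
      rw [← Submodule.Quotient.mk_smul, ← Submodule.Quotient.mk_smul,
        ← Submodule.Quotient.mk_smul, Submodule.Quotient.eq]
      have : u • a - c • x • a = (u - c * x) • a := by simp only [smul_eq_mul]; ring
      rw [this]
      exact Submodule.smul_mem_smul hx trivial
    simp only [hact] at hab
    exact (hc.smul_left_cancel).1 hab
  have hreg' : IsRegular R (l ++ [u]) := by
    refine ⟨hw', ?_⟩
    rw [ofList_perm (List.perm_append_singleton u l), hspan]
    exact hrs.top_ne_smul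
  exact isRegular_of_perm hreg' (List.perm_append_singleton u l)

lemma regular_cons_quot {R : Type} [CommRing R] (u : R) (l : List R) :
    IsRegular R (u :: l) ↔ IsSMulRegular R u ∧
      IsRegular (R ⧸ Ideal.span {u}) (l.map (Ideal.Quotient.mk (Ideal.span {u}))) := by
  rw [isRegular_cons_iff]
  refine and_congr_right' ?_
  have hu : (u • ⊤ : Submodule R R) = Ideal.span {u} := by
    rw [← Submodule.ideal_span_singleton_smul]
    simp
  let e : QuotSMulTop u R ≃ₗ[R] (R ⧸ Ideal.span {u}) := Submodule.quotEquivOfEq _ _ hu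
  refine e.toAddEquiv.isRegular_congr ?_
  rw [List.forall₂_map_right_iff, List.forall₂_same]
  intro r _ x
  exact (e.map_smul r x).trans (Algebra.smul_def _ _)

lemma ci_main {S T : Type} [CommRing S] [CommRing T]
    [IsLocalRing S] [IsLocalRing T] (ψ : S →+* T) (hψl : IsLocalHom ψ)
    (hpd : letI := ψ.toAlgebra; HasFiniteProjectiveDimension S T) (n : ℕ) :
    ∀ (R : Type) [CommRing R] [IsNoetherianRing R] [IsLocalRing R] (φ : R →+* S)
    (_ : Function.Surjective φ) (_ : IsLocalHom φ)
    (rs : List R) (_ : rs.length = n) (_ : IsRegular R rs)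
    (_ : Ideal.ofList rs = RingHom.ker (ψ.comp φ)),
    φ.IsCompleteIntersection ∧ ψ.IsCompleteIntersection := by
  have caseA : ∀ (R : Type) [CommRing R] [IsNoetherianRing R] [IsLocalRing R] (φ : R →+* S)
      (_ : Function.Surjective φ) (_ : IsLocalHom φ)
      (rs : List R) (_ : IsRegular R rs)
      (_ : Ideal.ofList rs = RingHom.ker (ψ.comp φ))
      (_ : RingHom.ker φ ≤ maximalIdeal R * RingHom.ker (ψ.comp φ)),
      φ.IsCompleteIntersection ∧ ψ.IsCompleteIntersection := by
    intro R _ _ _ φ hφs hφl rs hrs hker hle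
    have hloc : IsLocalHom (ψ.comp φ) := RingHom.isLocalHom_comp ψ φ
    have hbot := ker_eq_bot_of_le φ ψ hφs hloc hpd hle
    refine ⟨⟨[], IsRegular.nil R R, by rw [hbot, Ideal.ofList_nil]⟩, rs.map φ, ?_, ?_⟩
    · let e : R ≃+* S := RingEquiv.ofBijective φ ⟨(RingHom.injective_iff_ker_eq_bot φ).2 hbot, hφs⟩
      refine (e.toAddEquiv.isRegular_congr ?_).1 hrs
      rw [List.forall₂_map_right_iff, List.forall₂_same]
      intro r _ x
      exact e.map_mul r x
    · rw [← Ideal.map_ofList, hker, ← RingHom.comap_ker, Ideal.map_comap_of_surjective φ hφs]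
  induction n with
  | zero =>
    intro R _ _ _ φ hφs hφl rs hlen hrs hker
    refine caseA R φ hφs hφl rs hrs hker ?_
    have : rs = [] := List.length_eq_zero_iff.1 hlen
    subst this
    rw [Ideal.ofList_nil] at hker
    have h1 : RingHom.ker φ ≤ RingHom.ker (ψ.comp φ) := fun x hx => by
      rw [RingHom.mem_ker] at hx ⊢
      simp [hx]
    rw [← hker] at h1
    exact h1.trans bot_le
  | succ n ih =>
    intro R _ _ _ φ hφs hφl rs hlen hrs hker
    by_cases hle : RingHom.ker φ ≤ maximalIdeal R * RingHom.ker (ψ.comp φ)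
    · exact caseA R φ hφs hφl rs hrs hker hle
    obtain ⟨u, huφ, hu⟩ := SetLike.not_le_iff_exists.1 hle
    have huJ : u ∈ RingHom.ker (ψ.comp φ) := by
      rw [RingHom.mem_ker] at huφ ⊢
      simp [huφ]
    rw [← hker] at hu huJ
    obtain ⟨l, hl, hreg, hspan⟩ := exchange rs hrs u huJ hu
    rw [regular_cons_quot] at hreg
    have hum : u ∈ maximalIdeal R := fun h => by
      have := h.map φ
      rw [RingHom.mem_ker] at huφ
      rw [huφ] at this
      exact not_isUnit_zero this
    have hsle : Ideal.span {u} ≤ RingHom.ker φ := by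
      rwa [Ideal.span_singleton_le_iff_mem]
    have : Nontrivial (R ⧸ Ideal.span {u}) := Ideal.Quotient.nontrivial_iff.2 fun h => by
      have : (1 : R) ∈ maximalIdeal R := by
        have h2 : Ideal.span {u} ≤ maximalIdeal R := by
          rwa [Ideal.span_singleton_le_iff_mem]
        exact h2 (h ▸ trivial)
      exact this isUnit_one
    have hloc : IsLocalRing (R ⧸ Ideal.span {u}) :=
      IsLocalRing.of_surjective' (Ideal.Quotient.mk _) Ideal.Quotient.mk_surjective
    let φ' : R ⧸ Ideal.span {u} →+* S := Ideal.Quotient.lift _ φ hsle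
    have hφ' : φ'.comp (Ideal.Quotient.mk _) = φ := Ideal.Quotient.lift_comp_mk _ _ _
    have hφ's : Function.Surjective φ' := Ideal.Quotient.lift_surjective_of_surjective _ _ hφs
    have hφ'l : IsLocalHom φ' := by
      constructor
      intro a ha
      obtain ⟨a, rfl⟩ := Ideal.Quotient.mk_surjective a
      exact (hφl.map_nonunit a ha).map _
    have hmapker : ∀ (A : Type) [CommRing A] (χ : R ⧸ Ideal.span {u} →+* A),
        RingHom.ker χ = Ideal.map (Ideal.Quotient.mk (Ideal.span {u}))
          (RingHom.ker (χ.comp (Ideal.Quotient.mk (Ideal.span {u})))) := fun A _ χ => by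
      rw [← RingHom.comap_ker, Ideal.map_comap_of_surjective _ Ideal.Quotient.mk_surjective]
    have hmu : Ideal.map (Ideal.Quotient.mk (Ideal.span {u})) (Ideal.span {u}) = ⊥ :=
      Ideal.map_quotient_self _
    obtain ⟨⟨hs, hs1, hs2⟩, h2⟩ := ih (R ⧸ Ideal.span {u}) φ' hφ's hφ'l
      (l.map (Ideal.Quotient.mk _)) (by simp; omega) hreg.2 (by
        rw [hmapker, RingHom.comp_assoc, hφ', ← hker, ← hspan, Ideal.ofList_cons, Ideal.map_sup,
          hmu, bot_sup_eq, Ideal.map_ofList])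
    refine ⟨?_, h2⟩
    obtain ⟨hs', rfl⟩ : ∃ hs' : List R, hs'.map (Ideal.Quotient.mk (Ideal.span {u})) = hs :=
      List.map_surjective_iff.2 Ideal.Quotient.mk_surjective hs
    refine ⟨u :: hs', (regular_cons_quot u hs').2 ⟨hreg.1, hs1⟩, ?_⟩
    have h3 := congrArg (Ideal.comap (Ideal.Quotient.mk (Ideal.span {u}))) hs2
    rw [RingHom.comap_ker, hφ', ← Ideal.map_ofList,
      Ideal.comap_map_of_surjective _ Ideal.Quotient.mk_surjective] at h3
    rw [← h3, Ideal.ofList_cons, sup_comm]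
    congr 1
    exact (Ideal.mk_ker (I := Ideal.span {u})).symm

end

end AvramovFactor

theorem complete_intersection_factors
    (R S T : Type) [CommRing R] [CommRing S] [CommRing T]
    [IsNoetherianRing R] [IsNoetherianRing S] [IsNoetherianRing T]
    [IsLocalRing R] [IsLocalRing S] [IsLocalRing T]
    (φ : R →+* S) (ψ : S →+* T)
    (hφs : Function.Surjective φ) (hψs : Function.Surjective ψ)
    (hφl : IsLocalHom φ) (hψl : IsLocalHom ψ)
    (hci : (ψ.comp φ).IsCompleteIntersection)
    (hpd : letI := ψ.toAlgebra; HasFiniteProjectiveDimension S T) :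
    φ.IsCompleteIntersection ∧ ψ.IsCompleteIntersection := by
  obtain ⟨rs, hrs, hker⟩ := hci
  exact AvramovFactor.ci_main ψ hψl hpd rs.length R φ hφs hφl rs rfl hrs hker
end
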